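/- If positive integers n1 ≥ n2 ≥ n3 ≥ n4 and a satisfy F_{n1} + F_{n2} + F_{n3} + F_{n4} = 2^a with n1 > 350, then n1 − n3 ≤ 314. -/

import Mathlib

namespace FibPow

/-- evaluate `x` first, then apply `g` -/
noncomputable def frc (x : ℕ) (g : ℕ → Bool) : Bool :=
  Nat.rec (motive := fun _ => Bool) (g 0) (fun k _ => g (Nat.succ k)) x

/-- the product of all the moduli in use -/
def MM : ℕ := 85612363945200471785191059392251590660159559680

/-- A refinement step: indices known modulo `T` get refined modulo `q * T`; `A`, `B`, `C` are the
Fibonacci numbers with indices `T - 1`, `T`, `T + 1` modulo `MM`. -/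
structure Lvl where
  q : ℕ
  T : ℕ
  A : ℕ
  B : ℕ
  C : ℕ
  ts : List (ℕ × ℕ)

noncomputable def each (q A B C : ℕ) : ℕ → ℕ → (ℕ → ℕ → Bool) → Bool :=
  Nat.rec (motive := fun _ => ℕ → ℕ → (ℕ → ℕ → Bool) → Bool)
    (fun _ _ _ => true)
    (fun _ ih x y k => cond (k x y)
      (frc ((x * A + y * B) % MM) fun x' => frc ((x * B + y * C) % MM) fun y' => ih x' y' k)
      false) q

noncomputable def tst (S a : ℕ) (ts : List (ℕ × ℕ)) : Bool :=
  List.rec (motive := fun _ => Bool) true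
    (fun c _ ih => cond (Nat.beq ((S % c.1) ^ c.2 % c.1) (2 ^ (a * c.2) % c.1)) ih false) ts

/-- `true` if all branches die -/
noncomputable def run (a : ℕ) (ls : List Lvl) :
    ℕ → ℕ → ℕ → ℕ → ℕ → ℕ → ℕ → ℕ → Bool :=
  List.rec (motive := fun _ => ℕ → ℕ → ℕ → ℕ → ℕ → ℕ → ℕ → ℕ → Bool)
    (fun _ _ _ _ _ _ _ _ => false)
    (fun l _ ih x1 y1 x2 y2 x3 y3 x4 y4 =>
      each l.q l.A l.B l.C x1 y1 fun x1 y1 =>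
      each l.q l.A l.B l.C x2 y2 fun x2 y2 =>
      each l.q l.A l.B l.C x3 y3 fun x3 y3 =>
      frc (x1 + x2 + x3) fun s3 =>
      each l.q l.A l.B l.C x4 y4 fun x4 y4 =>
      frc (s3 + x4) fun s =>
      cond (tst s a l.ts) (ih x1 y1 x2 y2 x3 y3 x4 y4) true) ls

def lvls : List Lvl := [
  ⟨1, 48, 2971215073,
    4807526976,
    7778742049,
    [(23, 11)]⟩,
  ⟨2, 48, 2971215073,
    4807526976,
    7778742049,
    [(64, 1), (1103, 29), (47, 23)]⟩,
  ⟨2, 96, 31940434634990099905,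
    51680708854858323072,
    83621143489848422977,
    [(128, 1), (769, 64)]⟩,
  ⟨2, 192, 3691087032412706639440686994833808526209,
    5972304273877744135569338397692020533504,
    9663391306290450775010025392525829059713,
    [(256, 1), (1087, 181)]⟩,
  ⟨2, 384, 26128061819485213962437542705811054457228869377,
    56433695257997437855230259012802414292895277568,
    82561757077482651817667801718613468750124146945,
    [(512, 1), (127, 7), (383, 191)]⟩,
  ⟨5, 768, 48742682120445311281986169364039031574694671873,
    3407551250178549165819274518209244897388563456,
    52150233370623860447805443882248276472083235329,
    [(241, 4), (31, 5), (41, 10), (61, 10), (11, 5), (5, 2), (1601, 200), (641, 32)]⟩,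
  ⟨2, 3840, 80719991207643700866579414257978904360967626241,
    3936134536975943106675078483132521784650449920,
    84656125744619643973254492741111426145618076161,
    [(1024, 1), (7681, 640)]⟩,
  ⟨2, 7680, 46676875989574577195465701427187802875369815041,
    0,
    46676875989574577195465701427187802875369815041,
    [(2048, 1), (1689601, 6400)]⟩]

/-- `(fib r, fib (r+1))` for `r < 48`, `r` even or `r < 24` -/
def cls : List (ℕ × ℕ) := [(0, 1), (1, 1), (1, 2), (2, 3), (3, 5), (5, 8), (8, 13), (13, 21),
  (21, 34), (34, 55), (55, 89), (89, 144), (144, 233), (233, 377), (377, 610), (610, 987),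
  (987, 1597), (1597, 2584), (2584, 4181), (4181, 6765), (6765, 10946), (10946, 17711),
  (17711, 28657), (28657, 46368), (46368, 75025), (121393, 196418), (317811, 514229),
  (832040, 1346269), (2178309, 3524578), (5702887, 9227465), (14930352, 24157817),
  (39088169, 63245986), (102334155, 165580141), (267914296, 433494437), (701408733, 1134903170),
  (1836311903, 2971215073)]

noncomputable def sfx (l : List (ℕ × ℕ)) (k : ℕ → ℕ → List (ℕ × ℕ) → Bool) : Bool :=
  List.rec (motive := fun _ => Bool) true
    (fun c t ih => cond (k c.1 c.2 (c :: t)) ih false) l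

noncomputable def allA (k : ℕ → Bool) : Bool :=
  cond (k 12) (cond (k 13) (cond (k 14) (cond (k 15) (cond (k 16) (k 17) false) false) false)
    false) false

noncomputable def search : Bool :=
  sfx cls fun x1 y1 l1 => sfx l1 fun x2 y2 l2 => sfx l2 fun x3 y3 l3 =>
  frc (x1 + x2 + x3) fun s3 =>
  sfx l3 fun x4 y4 _ =>
  frc ((s3 + x4) % 2016) fun s =>
  cond (Nat.beq (s % 32) 0)
    (allA fun a => cond (Nat.beq s (2 ^ a % 2016)) (run a lvls x1 y1 x2 y2 x3 y3 x4 y4) true)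
    true

set_option maxRecDepth 100000 in
theorem search_true : search = true := by decide +kernel

theorem frc_eq (x : ℕ) (g : ℕ → Bool) : frc x g = g x := by cases x <;> rfl

theorem cond_and {b c : Bool} (h : cond b c false = true) : b = true ∧ c = true := by
  cases b <;> simp_all

theorem each_succ (q A B C x y : ℕ) (k : ℕ → ℕ → Bool) :
    each (q + 1) A B C x y k = cond (k x y)
      (each q A B C ((x * A + y * B) % MM) ((x * B + y * C) % MM) k) false := by
  show cond (k x y) (frc _ fun x' => frc _ fun y' => _) false = _
  rw [frc_eq, frc_eq]
  rfl

/-- `n ≡ r mod T` with `x`, `y` the Fibonacci numbers at `r`, `r + 1` -/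
def Inv (T n x y : ℕ) : Prop :=
  ∃ r t, n = r + T * t ∧ Nat.fib r ≡ x [MOD MM] ∧ Nat.fib (r + 1) ≡ y [MOD MM]

def Good (l : Lvl) : Prop := 0 < l.q ∧ 0 < l.T ∧ Nat.fib (l.T - 1) ≡ l.A [MOD MM] ∧
  Nat.fib l.T ≡ l.B [MOD MM] ∧ Nat.fib (l.T + 1) ≡ l.C [MOD MM] ∧
  ∀ c ∈ l.ts, c.1 ∣ MM ∧ c.1 ∣ Nat.fib (l.q * l.T) ∧ Nat.fib (l.q * l.T + 1) ≡ 1 [MOD c.1] ∧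
    2 ^ (17 * c.2) ≡ 2 ^ (11 * c.2) [MOD c.1]

theorem fib_shift {T A B C r x y : ℕ} (hT : 0 < T) (hA : Nat.fib (T - 1) ≡ A [MOD MM])
    (hB : Nat.fib T ≡ B [MOD MM]) (hC : Nat.fib (T + 1) ≡ C [MOD MM])
    (hx : Nat.fib r ≡ x [MOD MM]) (hy : Nat.fib (r + 1) ≡ y [MOD MM]) :
    Nat.fib (r + T) ≡ (x * A + y * B) % MM [MOD MM] ∧
    Nat.fib (r + T + 1) ≡ (x * B + y * C) % MM [MOD MM] := by
  obtain ⟨U, rfl⟩ : ∃ U, T = U + 1 := ⟨T - 1, by omega⟩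
  have e1 := Nat.fib_add r U
  have e2 := Nat.fib_add r (U + 1)
  constructor
  · refine Nat.ModEq.trans ?_ (Nat.mod_modEq _ _).symm
    rw [show r + (U + 1) = r + U + 1 from rfl, e1]
    exact (hx.mul hA).add (hy.mul hB)
  · refine Nat.ModEq.trans ?_ (Nat.mod_modEq _ _).symm
    rw [e2]
    exact (hx.mul hB).add (hy.mul hC)

theorem each_aux {T A B C : ℕ} (hT : 0 < T) (hA : Nat.fib (T - 1) ≡ A [MOD MM])
    (hB : Nat.fib T ≡ B [MOD MM]) (hC : Nat.fib (T + 1) ≡ C [MOD MM]) (k : ℕ → ℕ → Bool) (q : ℕ) :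
    ∀ r x y, Nat.fib r ≡ x [MOD MM] → Nat.fib (r + 1) ≡ y [MOD MM] →
      each q A B C x y k = true → ∀ j < q, ∃ x' y', Nat.fib (r + T * j) ≡ x' [MOD MM] ∧
        Nat.fib (r + T * j + 1) ≡ y' [MOD MM] ∧ k x' y' = true := by
  induction q with
  | zero => intro r x y _ _ _ j hj; omega
  | succ q ih =>
    intro r x y hx hy h j hj
    rw [each_succ] at h
    obtain ⟨h1, h2⟩ := cond_and h
    rcases j with _ | j
    · exact ⟨x, y, by simpa using hx, by simpa using hy, h1⟩
    · obtain ⟨hx', hy'⟩ := fib_shift hT hA hB hC hx hy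
      obtain ⟨x', y', a, b, c⟩ := ih (r + T) _ _ hx' hy' h2 j (by omega)
      have e : r + T * (j + 1) = r + T + T * j := by ring
      exact ⟨x', y', by rw [e]; exact a, by rw [e]; exact b, c⟩

theorem each_sound {l : Lvl} (hl : Good l) {n x y : ℕ} {k : ℕ → ℕ → Bool}
    (hn : Inv l.T n x y) (h : each l.q l.A l.B l.C x y k = true) :
    ∃ x' y', Inv (l.q * l.T) n x' y' ∧ k x' y' = true := by
  obtain ⟨hq, hT, hA, hB, hC, -⟩ := hl
  obtain ⟨r, t, rfl, hx, hy⟩ := hn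
  obtain ⟨x', y', a, b, c⟩ := each_aux hT hA hB hC k l.q r x y hx hy h (t % l.q) (Nat.mod_lt _ hq)
  refine ⟨x', y', ⟨r + l.T * (t % l.q), t / l.q, ?_, a, b⟩, c⟩
  conv_lhs => rw [← Nat.mod_add_div t l.q]
  ring

theorem fib_period {d T : ℕ} (h0 : d ∣ Nat.fib T) (h1 : Nat.fib (T + 1) ≡ 1 [MOD d]) (r t : ℕ) :
    Nat.fib (r + T * t) ≡ Nat.fib r [MOD d] := by
  have key : ∀ r, Nat.fib (r + T) ≡ Nat.fib r [MOD d] := by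
    intro r
    rcases r with _ | r
    · simpa using (Nat.modEq_zero_iff_dvd.2 h0)
    · have e := Nat.fib_add r T
      rw [show r + 1 + T = r + T + 1 by ring, e]
      have := ((Nat.modEq_zero_iff_dvd.2 h0).mul_left (Nat.fib r)).add
        (h1.mul_left (Nat.fib (r + 1)))
      simpa using this
  induction t with
  | zero => simp; rfl
  | succ t ih =>
    rw [show r + T * (t + 1) = r + T * t + T by ring]
    exact (key _).trans ih

theorem Inv.mod {d T n x y : ℕ} (hd : d ∣ MM) (h0 : d ∣ Nat.fib T)
    (h1 : Nat.fib (T + 1) ≡ 1 [MOD d]) (h : Inv T n x y) : Nat.fib n ≡ x [MOD d] := by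
  obtain ⟨r, t, rfl, hx, -⟩ := h
  exact (fib_period h0 h1 r t).trans (hx.of_dvd hd)

theorem pow_aux {d h : ℕ} (hp : 2 ^ (17 * h) ≡ 2 ^ (11 * h) [MOD d]) {a : ℕ} (ha : 11 ≤ a) (j : ℕ) :
    2 ^ ((a + 6 * j) * h) ≡ 2 ^ (a * h) [MOD d] := by
  induction j with
  | zero => simp; rfl
  | succ j ih =>
    refine Nat.ModEq.trans ?_ ih
    obtain ⟨b, rfl⟩ := Nat.exists_eq_add_of_le ha
    have := hp.mul_right (2 ^ ((b + 6 * j) * h))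
    rw [← pow_add, ← pow_add] at this
    convert this using 2 <;> ring

theorem pow_aux' {d h : ℕ} (hp : 2 ^ (17 * h) ≡ 2 ^ (11 * h) [MOD d]) {a e : ℕ} (ha : 11 ≤ a)
    (he : 11 ≤ e) (hae : e ≡ a [MOD 6]) : 2 ^ (e * h) ≡ 2 ^ (a * h) [MOD d] := by
  rcases le_total a e with hle | hle
  · obtain ⟨j, hj⟩ := (Nat.modEq_iff_dvd' hle).1 hae.symm
    obtain rfl : e = a + 6 * j := by omega
    exact pow_aux hp ha j
  · obtain ⟨j, hj⟩ := (Nat.modEq_iff_dvd' hle).1 hae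
    obtain rfl : a = e + 6 * j := by omega
    exact (pow_aux hp he j).symm

theorem tst_sound {S a : ℕ} (ts : List (ℕ × ℕ))
    (h : ∀ c ∈ ts, S ^ c.2 ≡ 2 ^ (a * c.2) [MOD c.1]) : tst S a ts = true := by
  induction ts with
  | nil => rfl
  | cons c t ih =>
    have h1 : Nat.beq ((S % c.1) ^ c.2 % c.1) (2 ^ (a * c.2) % c.1) = true := by
      rw [Nat.beq_eq]
      have := h c (by simp)
      rw [← Nat.pow_mod]
      exact this
    have h2 := ih (fun c hc => h c (by simp [hc]))
    show cond _ (tst S a t) false = true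
    rw [h1, h2]; rfl

/-- consecutive levels fit together -/
def Chain : ℕ → List Lvl → Prop
  | _, [] => True
  | T, l :: ls => l.T = T ∧ Good l ∧ Chain (l.q * l.T) ls

theorem run_sound {n1 n2 n3 n4 e a : ℕ} (ha : 11 ≤ a) (he : 11 ≤ e) (hae : e ≡ a [MOD 6])
    (hs : Nat.fib n1 + Nat.fib n2 + Nat.fib n3 + Nat.fib n4 ≡ 2 ^ e [MOD MM]) (ls : List Lvl) :
    ∀ T x1 y1 x2 y2 x3 y3 x4 y4, Chain T ls → Inv T n1 x1 y1 → Inv T n2 x2 y2 → Inv T n3 x3 y3 →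
      Inv T n4 x4 y4 → run a ls x1 y1 x2 y2 x3 y3 x4 y4 = true → False := by
  induction ls with
  | nil => intro T x1 y1 x2 y2 x3 y3 x4 y4 _ _ _ _ _ h; exact Bool.noConfusion h
  | cons l ls ih =>
    intro T x1 y1 x2 y2 x3 y3 x4 y4 hc i1 i2 i3 i4 h
    obtain ⟨rfl, hl, hc⟩ := hc
    obtain ⟨x1', y1', j1, h⟩ := each_sound hl i1 h
    obtain ⟨x2', y2', j2, h⟩ := each_sound hl i2 h
    obtain ⟨x3', y3', j3, h⟩ := each_sound hl i3 h
    rw [frc_eq] at h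
    obtain ⟨x4', y4', j4, h⟩ := each_sound hl i4 h
    rw [frc_eq] at h
    have ht : tst (x1' + x2' + x3' + x4') a l.ts = true := by
      apply tst_sound
      intro c hcm
      obtain ⟨d0, d1, d2, d3⟩ := hl.2.2.2.2.2 c hcm
      have s1 := (((j1.mod d0 d1 d2).add (j2.mod d0 d1 d2)).add (j3.mod d0 d1 d2)).add
        (j4.mod d0 d1 d2)
      have s2 := ((s1.symm.trans (hs.of_dvd d0)).pow c.2)
      rw [← pow_mul] at s2
      exact s2.trans (pow_aux' d3 ha he hae)
    rw [ht] at h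
    exact ih _ _ _ _ _ _ _ _ _ hc j1 j2 j3 j4 h

theorem sfx_sound {k : ℕ → ℕ → List (ℕ × ℕ) → Bool} (l : List (ℕ × ℕ)) (h : sfx l k = true) :
    ∀ i (hi : i < l.length), k (l[i]).1 (l[i]).2 (l.drop i) = true := by
  induction l with
  | nil => intro i hi; simp at hi
  | cons c t ih =>
    have h' : cond (k c.1 c.2 (c :: t)) (sfx t k) false = true := h
    obtain ⟨h1, h2⟩ := cond_and h'
    intro i hi
    rcases i with _ | i
    · simpa using h1
    · simpa using ih h2 i (by simpa using hi)

theorem sfx_drop {k : ℕ → ℕ → List (ℕ × ℕ) → Bool} {i j : ℕ} (hij : i ≤ j) (hj : j < cls.length)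
    (h : sfx (cls.drop i) k = true) : k (cls[j]).1 (cls[j]).2 (cls.drop j) = true := by
  have := sfx_sound _ h (j - i) (by simp; omega)
  simpa [List.drop_drop, Nat.add_sub_cancel' hij] using this

theorem allA_sound {k : ℕ → Bool} (h : allA k = true) (e : ℕ) :
    ∃ a, 12 ≤ a ∧ e ≡ a [MOD 6] ∧ k a = true := by
  unfold allA at h
  obtain ⟨h0, h⟩ := cond_and h
  obtain ⟨h1, h⟩ := cond_and h
  obtain ⟨h2, h⟩ := cond_and h
  obtain ⟨h3, h⟩ := cond_and h
  obtain ⟨h4, h5⟩ := cond_and h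
  have : e % 6 < 6 := Nat.mod_lt _ (by norm_num)
  unfold Nat.ModEq
  interval_cases hh : e % 6
  exacts [⟨12, by norm_num, by norm_num, h0⟩, ⟨13, by norm_num, by norm_num, h1⟩,
    ⟨14, by norm_num, by norm_num, h2⟩, ⟨15, by norm_num, by norm_num, h3⟩,
    ⟨16, by norm_num, by norm_num, h4⟩, ⟨17, by norm_num, by norm_num, h5⟩]

theorem period_MM : MM ∣ Nat.fib 15360 ∧ Nat.fib (15360 + 1) ≡ 1 [MOD MM] := by
  constructor
  · norm_num [MM]
  · norm_num [MM, Nat.ModEq]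

set_option maxRecDepth 100000 in
theorem chain_lvls : Chain 48 lvls := by
  simp only [lvls, Chain, Good, List.forall_mem_cons, List.not_mem_nil, false_imp_iff,
    implies_true, and_true, true_and]
  norm_num [MM, Nat.ModEq]
  decide +kernel

/-- reflection: `fib (N - j) = ± fib j` modulo a period `N` -/
theorem fib_reflect {N : ℕ} (h0 : MM ∣ Nat.fib N) (h1 : Nat.fib (N + 1) ≡ 1 [MOD MM]) (j : ℕ) :
    (2 * j ≤ N → ((Nat.fib (N - 2 * j) : ℤ) : ZMod MM) = - (Nat.fib (2 * j) : ℤ)) ∧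
    (2 * j + 1 ≤ N → ((Nat.fib (N - (2 * j + 1)) : ℤ) : ZMod MM) = (Nat.fib (2 * j + 1) : ℤ)) := by
  have h0' : ((Nat.fib N : ℕ) : ZMod MM) = 0 := (ZMod.natCast_eq_zero_iff _ _).2 h0
  have h1' : ((Nat.fib (N + 1) : ℕ) : ZMod MM) = 1 := by
    simpa using (ZMod.natCast_eq_natCast_iff _ _ _).2 h1
  induction j with
  | zero =>
    refine ⟨fun _ => by simpa using h0', fun h => ?_⟩
    obtain ⟨K, rfl⟩ : ∃ K, N = K + 1 := ⟨N - 1, by omega⟩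
    have := Nat.fib_add_two (n := K)
    rw [this] at h1'
    push_cast at h1'
    rw [h0'] at h1'
    simpa using h1'
  | succ j ih =>
    have A : 2 * (j + 1) ≤ N →
        ((Nat.fib (N - 2 * (j + 1)) : ℤ) : ZMod MM) = - (Nat.fib (2 * (j + 1)) : ℤ) := by
      intro h
      have i1 := ih.1 (by omega)
      have i2 := ih.2 (by omega)
      obtain ⟨K, rfl⟩ : ∃ K, N = K + 2 * (j + 1) := ⟨N - 2 * (j + 1), by omega⟩
      rw [show K + 2 * (j + 1) - 2 * j = K + 2 by omega, Nat.fib_add_two] at i1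
      rw [show K + 2 * (j + 1) - (2 * j + 1) = K + 1 by omega] at i2
      rw [show K + 2 * (j + 1) - 2 * (j + 1) = K by omega,
        show 2 * (j + 1) = 2 * j + 2 by ring, Nat.fib_add_two]
      push_cast at *
      linear_combination i1 - i2
    refine ⟨A, fun h => ?_⟩
    have i1 := A (by omega)
    have i2 := ih.2 (by omega)
    obtain ⟨K, rfl⟩ : ∃ K, N = K + (2 * (j + 1) + 1) := ⟨N - (2 * (j + 1) + 1), by omega⟩
    rw [show K + (2 * (j + 1) + 1) - (2 * j + 1) = K + 2 by omega, Nat.fib_add_two] at i2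
    rw [show K + (2 * (j + 1) + 1) - 2 * (j + 1) = K + 1 by omega] at i1
    rw [show K + (2 * (j + 1) + 1) - (2 * (j + 1) + 1) = K by omega,
      show 2 * (j + 1) + 1 = 2 * j + 1 + 2 by ring, Nat.fib_add_two]
    rw [show 2 * (j + 1) = 2 * j + 1 + 1 by ring] at i1
    push_cast at *
    linear_combination i2 - i1

theorem cls_get : ∀ r < 48, (r % 2 = 0 ∨ r < 24) → ∃ i, ∃ h : i < cls.length,
    cls[i] = (Nat.fib r, Nat.fib (r + 1)) := by
  intro r hr h
  refine ⟨if r < 24 then r else 12 + r / 2, by simp only [cls, List.length]; split_ifs <;> omega, ?_⟩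
  interval_cases r <;> first | rfl | omega

theorem exists_cls (n : ℕ) : ∃ n' i, ∃ h : i < cls.length, Nat.fib n' ≡ Nat.fib n [MOD MM] ∧
    Inv 48 n' (cls[i]).1 (cls[i]).2 := by
  have key : ∃ n', Nat.fib n' ≡ Nat.fib n [MOD MM] ∧ (n' % 48 % 2 = 0 ∨ n' % 48 < 24) := by
    by_cases hc : n % 48 % 2 = 0 ∨ n % 48 < 24
    · exact ⟨n, rfl, hc⟩
    · push Not at hc
      obtain ⟨j, rfl⟩ : ∃ j, n = 2 * j + 1 := ⟨n / 2, by omega⟩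
      have p0 : MM ∣ Nat.fib (15360 * (2 * j + 1)) :=
        period_MM.1.trans (Nat.fib_dvd _ _ (Dvd.intro _ rfl))
      have p1 : Nat.fib (15360 * (2 * j + 1) + 1) ≡ 1 [MOD MM] := by
        have := fib_period period_MM.1 period_MM.2 1 (2 * j + 1)
        rw [add_comm]
        simpa using this
      have := (fib_reflect p0 p1 j).2 (by omega)
      have hm : (15360 * (2 * j + 1) - (2 * j + 1)) % 48 < 24 := by
        obtain ⟨k, c, hk, h24, h48⟩ : ∃ k c, 2 * j + 1 = 48 * k + c ∧ 24 < c ∧ c < 48 :=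
          ⟨(2 * j + 1) / 48, (2 * j + 1) % 48, by omega, by omega, by omega⟩
        have : 15360 * (2 * j + 1) - (2 * j + 1)
            = (48 - c) + 48 * (320 * (2 * j + 1) - k - 1) := by omega
        rw [this, Nat.add_mul_mod_self_left]
        exact lt_of_le_of_lt (Nat.mod_le _ _) (by clear this; omega)
      refine ⟨15360 * (2 * j + 1) - (2 * j + 1), ?_, Or.inr hm⟩
      rw [← ZMod.natCast_eq_natCast_iff]
      simpa using this
  obtain ⟨n', h1, h2⟩ := key
  obtain ⟨i, hi, e⟩ := cls_get (n' % 48) (Nat.mod_lt _ (by norm_num)) h2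
  refine ⟨n', i, hi, h1, n' % 48, n' / 48, (Nat.mod_add_div _ _).symm, ?_, ?_⟩ <;> rw [e]

theorem sorted_false {n1 n2 n3 n4 e i1 i2 i3 i4 : ℕ} (he : 11 ≤ e) (h12 : i1 ≤ i2) (h23 : i2 ≤ i3)
    (h34 : i3 ≤ i4) (l1 : i1 < cls.length) (l2 : i2 < cls.length) (l3 : i3 < cls.length)
    (l4 : i4 < cls.length)
    (v1 : Inv 48 n1 (cls[i1]).1 (cls[i1]).2) (v2 : Inv 48 n2 (cls[i2]).1 (cls[i2]).2)
    (v3 : Inv 48 n3 (cls[i3]).1 (cls[i3]).2) (v4 : Inv 48 n4 (cls[i4]).1 (cls[i4]).2)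
    (hs : Nat.fib n1 + Nat.fib n2 + Nat.fib n3 + Nat.fib n4 ≡ 2 ^ e [MOD MM]) : False := by
  have h := search_true
  unfold search at h
  have h := sfx_drop (i := 0) (Nat.zero_le i1) l1 h
  have h := sfx_drop h12 l2 h
  have h := sfx_drop h23 l3 h
  rw [frc_eq] at h
  have h := sfx_drop h34 l4 h
  rw [frc_eq] at h
  have d0 : 2016 ∣ MM := by norm_num [MM]
  have d1 : 2016 ∣ Nat.fib 48 := by norm_num
  have d2 : Nat.fib (48 + 1) ≡ 1 [MOD 2016] := by norm_num [Nat.ModEq]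
  have s1 := (((v1.mod d0 d1 d2).add (v2.mod d0 d1 d2)).add (v3.mod d0 d1 d2)).add
    (v4.mod d0 d1 d2)
  have s2 := s1.symm.trans (hs.of_dvd d0)
  have s3 : ((cls[i1]).1 + (cls[i2]).1 + (cls[i3]).1 + (cls[i4]).1) % 2016 = 2 ^ e % 2016 := s2
  have b1 : Nat.beq (((cls[i1]).1 + (cls[i2]).1 + (cls[i3]).1 + (cls[i4]).1) % 2016 % 32) 0
      = true := by
    rw [Nat.beq_eq, s3, Nat.mod_mod_of_dvd _ (by norm_num)]
    obtain ⟨f, rfl⟩ := Nat.exists_eq_add_of_le he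
    rw [pow_add]
    omega
  rw [b1, cond_true] at h
  obtain ⟨a, ha, hae, h⟩ := allA_sound h e
  have b2 : Nat.beq (((cls[i1]).1 + (cls[i2]).1 + (cls[i3]).1 + (cls[i4]).1) % 2016)
      (2 ^ a % 2016) = true := by
    rw [Nat.beq_eq, s3]
    have := pow_aux' (d := 2016) (h := 1) (by norm_num [Nat.ModEq]) (by omega : 11 ≤ a) he hae
    simpa [Nat.ModEq] using this
  rw [b2, cond_true] at h
  exact run_sound (by omega) he hae hs lvls 48 _ _ _ _ _ _ _ _ chain_lvls v1 v2 v3 v4 h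

theorem no_sol {n1 n2 n3 n4 e : ℕ} (he : 11 ≤ e)
    (hs : Nat.fib n1 + Nat.fib n2 + Nat.fib n3 + Nat.fib n4 = 2 ^ e) : False := by
  obtain ⟨m1, i1, l1, f1, v1⟩ := exists_cls n1
  obtain ⟨m2, i2, l2, f2, v2⟩ := exists_cls n2
  obtain ⟨m3, i3, l3, f3, v3⟩ := exists_cls n3
  obtain ⟨m4, i4, l4, f4, v4⟩ := exists_cls n4
  have hm : Nat.fib m1 + Nat.fib m2 + Nat.fib m3 + Nat.fib m4 ≡ 2 ^ e [MOD MM] := by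
    rw [← hs]; exact ((f1.add f2).add f3).add f4
  clear f1 f2 f3 f4 hs
  wlog g12 : i1 ≤ i2 generalizing i1 i2 m1 m2
  · exact this m2 i2 l2 v2 m1 i1 l1 v1 (by rw [add_comm (Nat.fib m2)]; exact hm) (by omega)
  wlog g34 : i3 ≤ i4 generalizing i3 i4 m3 m4
  · exact this m4 i4 l4 v4 m3 i3 l3 v3
      (by rw [add_right_comm]; exact hm) (by omega)
  wlog g13 : i1 ≤ i3 generalizing i1 i2 i3 i4 m1 m2 m3 m4
  · exact this m3 i3 l3 v3 m4 i4 l4 v4 g34 m1 i1 l1 v1 m2 i2 l2 v2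
      (by convert hm using 1; ring) g12 (by omega)
  rcases le_total i2 i3 with g | g
  · exact sorted_false he g12 g g34 l1 l2 l3 l4 v1 v2 v3 v4 hm
  · rcases le_total i2 i4 with g' | g'
    · exact sorted_false he g13 g g' l1 l3 l2 l4 v1 v3 v2 v4 (by convert hm using 1; ring)
    · exact sorted_false he g13 g34 g' l1 l3 l4 l2 v1 v3 v4 v2 (by convert hm using 1; ring)

end FibPow

/-- If positive integers `n1 ≥ n2 ≥ n3 ≥ n4` and `a` satisfy
`F_{n1} + F_{n2} + F_{n3} + F_{n4} = 2^a` with `n1 > 350`, then `n1 − n3 ≤ 314`. -/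
theorem n1_sub_n3_le_314
    (n1 n2 n3 n4 a : ℕ) (hn4 : 0 < n4) (ha : 0 < a) (hn1 : 350 < n1)
    (h12 : n2 ≤ n1) (h23 : n3 ≤ n2) (h34 : n4 ≤ n3)
    (h : Nat.fib n1 + Nat.fib n2 + Nat.fib n3 + Nat.fib n4 = 2 ^ a) :
    n1 - n3 ≤ 314 := by
  exfalso
  refine FibPow.no_sol (e := a) ?_ h
  by_contra hlt
  have h1 : 2 ^ a ≤ 2 ^ 10 := Nat.pow_le_pow_right (by norm_num) (by omega)
  have h2 : Nat.fib 20 ≤ Nat.fib n1 := Nat.fib_mono (by omega)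
  have h3 : Nat.fib 20 = 6765 := by norm_num
  omega
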